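/- Let f : ℝ × ℝ^N → ℝ^N be Lipschitz Carathéodory and satisfy: (H1) there are locally integrable α, β : ℝ → ℝ with β(t) ≥ 0 such that 2⟨f(t,x), x⟩ ≤ α(t)|x|² + β(t) for Lebesgue-a.e. (t,x) ∈ ℝ^{1+N}; (H2•) there are constants α₁ > 0 and K ≥ 1 such that exp(∫_s^t α(u) du) ≤ K e^{−α₁(t−s)} for all s ≤ t in ℝ; (H3) c₁ := sup_{t ∈ ℝ} ∫_t^{t+1} β(u) du < ∞. Then there exists ρ > 0 such that for every d > 0 there is T(d) > 0 with |x(t, f, t−s, x₀)| ≤ ρ whenever t ∈ ℝ, s ≥ T(d), and |x₀| ≤ d; that is, the closed ball of radius ρ is a bounded pullback absorbing set for the process induced by f, uniformly in t, and equivalently the solutions of ẋ = f(t,x) are uniformly ultimately bounded. -/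

import Mathlib

open MeasureTheory Set Filter Topology
open scoped RealInnerProductSpace

noncomputable section

abbrev Euc (n : ℕ) := EuclideanSpace ℝ (Fin n)

/-- A function `ℝ → ℝ` is locally integrable (w.r.t. Lebesgue measure) on every
compact interval. -/
def LocInt (m : ℝ → ℝ) : Prop := ∀ a b : ℝ, IntegrableOn m (Icc a b)

section Defs

variable {N : ℕ} {F : Type*} [NormedAddCommGroup F] [NormedSpace ℝ F]

/-- The Carathéodory conditions (C1) and (C2). -/
def IsCara (f : ℝ → Euc N → F) : Prop :=
  StronglyMeasurable (Function.uncurry f) ∧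
  ∀ K : Set (Euc N), IsCompact K → ∃ m : ℝ → ℝ, (∀ t, 0 ≤ m t) ∧ LocInt m ∧
    ∀ᵐ t : ℝ, ∀ x ∈ K, ‖f t x‖ ≤ m t

/-- A suitable set of moduli of continuity `Θ = {θ_j^{[q₁,q₂]}}`. -/
structure SuitableModuli where
  θ : ℕ → ℚ → ℚ → ℝ → ℝ
  nonneg : ∀ j q₁ q₂ s, (0:ℝ) ≤ s → 0 ≤ θ j q₁ q₂ s
  cont : ∀ j q₁ q₂, ContinuousOn (θ j q₁ q₂) (Ici 0)
  mono : ∀ j q₁ q₂, MonotoneOn (θ j q₁ q₂) (Ici 0)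
  zero : ∀ j q₁ q₂, θ j q₁ q₂ 0 = 0
  ordered : ∀ j₁ j₂ q₁ q₂ p₁ p₂, j₁ ≤ j₂ → p₁ ≤ q₁ → q₂ ≤ p₂ →
    ∀ s : ℝ, 0 ≤ s → θ j₁ q₁ q₂ s ≤ θ j₂ p₁ p₂ s

/-- `x ∈ K_j^{[q₁,q₂]}`: continuous, bounded by `j` and with modulus of continuity
`θ_j^{[q₁,q₂]}` on `[q₁,q₂]`. -/
def inK {N : ℕ} (Θ : SuitableModuli) (j : ℕ) (q₁ q₂ : ℚ) (x : ℝ → Euc N) : Prop :=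
  ContinuousOn x (Icc (q₁:ℝ) (q₂:ℝ)) ∧
  (∀ t ∈ Icc (q₁:ℝ) (q₂:ℝ), ‖x t‖ ≤ (j:ℝ)) ∧
  ∀ t ∈ Icc (q₁:ℝ) (q₂:ℝ), ∀ s ∈ Icc (q₁:ℝ) (q₂:ℝ), ‖x t - x s‖ ≤ Θ.θ j q₁ q₂ |t - s|

/-- Weak Θ-Carathéodory functions: Carathéodory conditions plus condition (W). -/
def IsWTC (Θ : SuitableModuli) (f : ℝ → Euc N → F) : Prop :=
  IsCara f ∧
  ∀ (j : ℕ) (q₁ q₂ : ℚ) (xs : ℕ → ℝ → Euc N) (x : ℝ → Euc N),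
    (∀ n, inK Θ j q₁ q₂ (xs n)) → inK Θ j q₁ q₂ x →
    TendstoUniformlyOn (fun n t => xs n t) x atTop (Icc (q₁:ℝ) (q₂:ℝ)) →
    Tendsto (fun n => ∫ t in Icc (q₁:ℝ) (q₂:ℝ), f t (xs n t)) atTop
      (𝓝 (∫ t in Icc (q₁:ℝ) (q₂:ℝ), f t (x t)))

/-- Convergence in the `σ_Θ` sense:
`sup_{x ∈ K_j^I} ‖∫_I (f_n(t,x(t)) − f(t,x(t))) dt‖ → 0` for every `j` and `I`. -/
def SigmaTendsto (Θ : SuitableModuli) (fs : ℕ → ℝ → Euc N → F) (f : ℝ → Euc N → F) : Prop :=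
  ∀ (j : ℕ) (q₁ q₂ : ℚ), ∀ ε > (0:ℝ), ∀ᶠ n in atTop, ∀ x : ℝ → Euc N, inK Θ j q₁ q₂ x →
    ‖∫ t in Icc (q₁:ℝ) (q₂:ℝ), (fs n t (x t) - f t (x t))‖ < ε

end Defs

/-- Lipschitz Carathéodory functions. -/
def IsLC {N : ℕ} (f : ℝ → Euc N → Euc N) : Prop :=
  IsCara f ∧
  ∀ K : Set (Euc N), IsCompact K → ∃ l : ℝ → ℝ, LocInt l ∧
    ∀ᵐ t : ℝ, ∀ x ∈ K, ∀ y ∈ K, ‖f t x - f t y‖ ≤ l t * ‖x - y‖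

/-- The optimal m-bound of `f` on the closed ball `B_j`. -/
def mOpt {N : ℕ} (f : ℝ → Euc N → Euc N) (j : ℕ) (t : ℝ) : ℝ :=
  sSup {v : ℝ | ∃ x : Euc N, ‖x‖ ≤ (j:ℝ) ∧ v = ‖f t x‖}

/-- The time translation `f_r(s,x) = f(s+r,x)`. -/
def timeTranslate {N : ℕ} (f : ℝ → Euc N → Euc N) (r : ℝ) : ℝ → Euc N → Euc N :=
  fun s x => f (s + r) x

/-- `x` is a solution of `ẋ = g(t,x)`, `x(0) = x₀`, defined on `[0,∞)`. -/
def IsSolOn {N : ℕ} (g : ℝ → Euc N → Euc N) (x₀ : Euc N) (x : ℝ → Euc N) : Prop :=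
  ContinuousOn x (Ici 0) ∧ ∀ t ∈ Ici (0:ℝ), x t = x₀ + ∫ s in (0:ℝ)..t, g s (x s)

namespace AbsolutelyContinuousOnInterval

theorem of_dist_le {X Y : Type*} [PseudoMetricSpace X] [PseudoMetricSpace Y]
    {g : ℝ → X} {h : ℝ → Y} {a b C : ℝ} (hg : AbsolutelyContinuousOnInterval g a b)
    (H : ∀ x ∈ uIcc a b, ∀ y ∈ uIcc a b, dist (h x) (h y) ≤ C * dist (g x) (g y)) :
    AbsolutelyContinuousOnInterval h a b := by
  rw [absolutelyContinuousOnInterval_iff] at hg ⊢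
  intro ε hε
  have hC : 0 < |C| + 1 := by positivity
  obtain ⟨δ, hδ, hgδ⟩ := hg (ε / (|C| + 1)) (by positivity)
  refine ⟨δ, hδ, fun E hE hEδ => ?_⟩
  have h1 := hgδ E hE hEδ
  rw [lt_div_iff₀ hC] at h1
  refine lt_of_le_of_lt ?_ h1
  rw [Finset.sum_mul]
  refine Finset.sum_le_sum fun i hi => ?_
  have hi' := hE.1 i hi
  refine (H _ hi'.1 _ hi'.2).trans ?_
  rw [mul_comm]
  gcongr
  linarith [le_abs_self C]

theorem exp {g : ℝ → ℝ} {a b : ℝ} (hg : AbsolutelyContinuousOnInterval g a b) :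
    AbsolutelyContinuousOnInterval (fun t => Real.exp (g t)) a b := by
  obtain ⟨M, hM⟩ := hg.exists_bound
  obtain ⟨L, hL⟩ := (Real.contDiff_exp (n := 1)).contDiffOn.exists_lipschitzOnWith (by decide)
    (convex_Icc (-M) M) isCompact_Icc
  exact hg.of_dist_le fun x hx y hy =>
    hL.dist_le_mul _ (abs_le.mp (hM x hx)) _ (abs_le.mp (hM y hy))

/-- Grönwall's inequality for absolutely continuous functions. -/
theorem le_exp_integral {φ α β : ℝ → ℝ} {a b : ℝ} (hab : a ≤ b)
    (hφ : AbsolutelyContinuousOnInterval φ a b)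
    (hα : IntervalIntegrable α volume a b) (hβ : IntervalIntegrable β volume a b)
    (h : ∀ᵐ t, t ∈ uIcc a b → deriv φ t ≤ α t * φ t + β t) :
    φ b ≤ φ a * Real.exp (∫ u in a..b, α u) + ∫ v in a..b, β v * Real.exp (∫ u in v..b, α u) := by
  have hA : AbsolutelyContinuousOnInterval (fun v => ∫ u in v..b, α u) a b := by
    simp_rw [fun v => intervalIntegral.integral_symm (μ := volume) (f := α) b v]
    exact (hα.absolutelyContinuousOnInterval_intervalIntegral right_mem_uIcc).neg
  have hE := hA.exp
  have hψ := hφ.mul hE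
  have key : ∫ v in a..b, deriv (φ * fun v => Real.exp (∫ u in v..b, α u)) v ≤
      ∫ v in a..b, β v * Real.exp (∫ u in v..b, α u) := by
    refine intervalIntegral.integral_mono_ae_restrict hab hψ.intervalIntegrable_deriv
      (hβ.mul_continuousOn hE.continuousOn) ?_
    rw [EventuallyLE, ae_restrict_iff' measurableSet_Icc, ← uIcc_of_le hab]
    filter_upwards [h, hφ.ae_differentiableAt, hα.ae_hasDerivAt_integral] with t h1 h2 h3 ht
    have hd : HasDerivAt (fun v => ∫ u in v..b, α u) (-α t) t := by
      simp_rw [fun v => intervalIntegral.integral_symm (μ := volume) (f := α) b v]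
      exact (h3 ht b right_mem_uIcc).neg
    rw [((h2 ht).hasDerivAt.mul hd.exp).deriv]
    nlinarith [mul_le_mul_of_nonneg_right (h1 ht) (Real.exp_pos (∫ u in t..b, α u)).le]
  rw [hψ.integral_deriv_eq_sub] at key
  simp only [Pi.mul_apply, intervalIntegral.integral_same, Real.exp_zero, mul_one] at key
  linarith

end AbsolutelyContinuousOnInterval

theorem LocInt.intervalIntegrable {m : ℝ → ℝ} (hm : LocInt m) (a b : ℝ) :
    IntervalIntegrable m volume a b :=
  (hm (min a b) (max a b)).intervalIntegrable

theorem IsLC.ae_continuous {N : ℕ} {f : ℝ → Euc N → Euc N} (hf : IsLC f) :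
    ∀ᵐ t, Continuous (f t) := by
  have h (n : ℕ) : ∀ᵐ t, ContinuousOn (f t) (Metric.closedBall 0 n) := by
    obtain ⟨l, -, hl⟩ := hf.2 _ (isCompact_closedBall (0 : Euc N) n)
    filter_upwards [hl] with t ht
    refine LipschitzOnWith.continuousOn (K := (l t).toNNReal) ?_
    refine LipschitzOnWith.of_dist_le_mul fun x hx y hy => ?_
    rw [dist_eq_norm, dist_eq_norm]
    refine (ht x hx y hy).trans ?_
    gcongr
    exact Real.le_coe_toNNReal _
  filter_upwards [ae_all_iff.mpr h] with t ht
  refine continuous_iff_continuousAt.mpr fun x => ?_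
  obtain ⟨n, hn⟩ := exists_nat_gt ‖x‖
  exact (ht n).continuousAt (Metric.closedBall_mem_nhds_of_mem (by simpa using hn))

/-- A dissipativity inequality valid for a.e. `(t, x)` holds, for a.e. `t`, at every `x`. -/
theorem IsLC.ae_forall_inner_le {N : ℕ} {f : ℝ → Euc N → Euc N} (hf : IsLC f) {α β : ℝ → ℝ}
    (h : ∀ᵐ p : ℝ × Euc N, 2 * ⟪f p.1 p.2, p.2⟫ ≤ α p.1 * ‖p.2‖ ^ 2 + β p.1) :
    ∀ᵐ t, ∀ x, 2 * ⟪f t x, x⟫ ≤ α t * ‖x‖ ^ 2 + β t := by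
  rw [Measure.volume_eq_prod] at h
  filter_upwards [Measure.ae_ae_of_ae_prod h, hf.ae_continuous] with t ht hc x
  have hcl : IsClosed {x | 2 * ⟪f t x, x⟫ ≤ α t * ‖x‖ ^ 2 + β t} :=
    isClosed_le (by fun_prop) (by fun_prop)
  exact hcl.closure_subset (Measure.dense_of_ae ht x)

theorem IsCara.intervalIntegrable_comp {N : ℕ} {f : ℝ → Euc N → Euc N} (hf : IsCara f)
    {x : ℝ → Euc N} {a b : ℝ} (hab : a ≤ b) (hx : ContinuousOn x (Icc a b)) :
    IntervalIntegrable (fun v => f v (x v)) volume a b := by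
  rw [intervalIntegrable_iff_integrableOn_Icc_of_le hab]
  obtain ⟨m, -, hm, hb⟩ := hf.2 _ (isCompact_Icc.image_of_continuousOn hx)
  refine Integrable.mono' (hm a b) ?_ ?_
  · exact (hf.1.measurable.comp_aemeasurable
      (aemeasurable_id.prodMk (hx.aemeasurable measurableSet_Icc))).aestronglyMeasurable
  · rw [ae_restrict_iff' measurableSet_Icc]
    filter_upwards [hb] with t ht hts
    exact ht _ (mem_image_of_mem x hts)

theorem IntervalIntegrable.absolutelyContinuousOnInterval_norm_add_integral {E : Type*}
    [NormedAddCommGroup E] [NormedSpace ℝ E] {g : ℝ → E} {a b : ℝ}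
    (hg : IntervalIntegrable g volume a b) (x₀ : E) :
    AbsolutelyContinuousOnInterval (fun u => ‖x₀ + ∫ v in a..u, g v‖) a b := by
  refine (hg.norm.absolutelyContinuousOnInterval_intervalIntegral left_mem_uIcc).of_dist_le
    (C := 1) fun s hs t ht => ?_
  have hsub {u v : ℝ} (hu : u ∈ uIcc a b) (hv : v ∈ uIcc a b) :
      IntervalIntegrable g volume u v := hg.mono_set (uIcc_subset_uIcc hu hv)
  have h1 := hsub left_mem_uIcc hs
  have h2 := hsub left_mem_uIcc ht
  rw [one_mul, Real.dist_eq, Real.dist_eq,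
    intervalIntegral.integral_interval_sub_left h1.norm h2.norm]
  refine (abs_norm_sub_norm_le _ _).trans ?_
  rw [add_sub_add_left_eq_sub, intervalIntegral.integral_interval_sub_left h1 h2]
  exact intervalIntegral.norm_integral_le_abs_integral_norm

/-- The a priori bound on the squared norm of a solution of a dissipative equation. -/
theorem IsLC.norm_sq_le {N : ℕ} {f : ℝ → Euc N → Euc N} (hf : IsLC f) {α β : ℝ → ℝ}
    (hα : LocInt α) (hβ : LocInt β)
    (h : ∀ᵐ p : ℝ × Euc N, 2 * ⟪f p.1 p.2, p.2⟫ ≤ α p.1 * ‖p.2‖ ^ 2 + β p.1)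
    {a b : ℝ} (hab : a ≤ b) {x₀ : Euc N} {x : ℝ → Euc N} (hx : ContinuousOn x (Icc a b))
    (hsol : ∀ u ∈ Icc a b, x u = x₀ + ∫ v in a..u, f v (x v)) :
    ‖x b‖ ^ 2 ≤ ‖x₀‖ ^ 2 * Real.exp (∫ u in a..b, α u) +
      ∫ v in a..b, β v * Real.exp (∫ u in v..b, α u) := by
  have hg := hf.1.intervalIntegrable_comp hab hx
  have hn := hg.absolutelyContinuousOnInterval_norm_add_integral x₀
  have hac := hn.mul hn
  have key := hac.le_exp_integral hab (hα.intervalIntegrable a b) (hβ.intervalIntegrable a b) ?_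
  · simpa [← pow_two, ← hsol b (right_mem_Icc.mpr hab)] using key
  · filter_upwards [hf.ae_forall_inner_le h, hg.ae_hasDerivAt_integral] with t h1 h2 ht
    have hd := ((h2 ht a left_mem_uIcc).const_add x₀).norm_sq
    have hxt := hsol t (uIcc_of_le hab ▸ ht)
    simp only [pow_two] at hd
    have h3 := h1 (x t)
    have hd' := hd.deriv
    rw [← hxt, real_inner_comm] at hd'
    refine hd'.trans_le (h3.trans_eq ?_)
    simp [← hxt, pow_two]

theorem integral_mul_exp_nat_le {β : ℝ → ℝ} (hβ : LocInt β) (hβ0 : ∀ t, 0 ≤ β t) {c r : ℝ}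
    (hr : 0 < r) (hc : ∀ t, ∫ u in t..(t + 1), β u ≤ c) (n : ℕ) (t : ℝ) :
    ∫ v in (t - n)..t, β v * Real.exp (-r * (t - v)) ≤ c / (1 - Real.exp (-r)) := by
  have hq : 0 < 1 - Real.exp (-r) := by simpa using hr
  have hint (s a b : ℝ) : IntervalIntegrable (fun v => β v * Real.exp (-r * (s - v))) volume a b :=
    (hβ.intervalIntegrable a b).mul_continuousOn (by fun_prop)
  induction n generalizing t with
  | zero =>
    have : 0 ≤ c := (intervalIntegral.integral_nonneg (by simp) fun u _ => hβ0 u).trans (hc 0)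
    simpa using div_nonneg this hq.le
  | succ n ih =>
    have h1 : ∫ v in (t - (n + 1 : ℕ))..(t - 1), β v * Real.exp (-r * (t - v)) =
        Real.exp (-r) * ∫ v in ((t - 1) - n)..(t - 1), β v * Real.exp (-r * ((t - 1) - v)) := by
      rw [← intervalIntegral.integral_const_mul]
      congr 1
      · ext v
        rw [mul_left_comm, ← Real.exp_add]
        ring_nf
      · push_cast; ring
    have h2 : ∫ v in (t - 1)..t, β v * Real.exp (-r * (t - v)) ≤ c := by
      refine le_trans ?_ ((sub_add_cancel t 1) ▸ hc (t - 1))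
      refine intervalIntegral.integral_mono_on (by linarith) (hint t _ _)
        (hβ.intervalIntegrable _ _) fun v hv => ?_
      refine mul_le_of_le_one_right (hβ0 v) (Real.exp_le_one_iff.mpr ?_)
      nlinarith [hv.2]
    rw [← intervalIntegral.integral_add_adjacent_intervals (hint t _ (t - 1)) (hint t _ _), h1]
    have h3 := mul_le_mul_of_nonneg_left (ih (t - 1)) (Real.exp_pos (-r)).le
    have h4 : Real.exp (-r) * (c / (1 - Real.exp (-r))) + c = c / (1 - Real.exp (-r)) := by
      field_simp; ring
    linarith

theorem integral_mul_exp_le {β : ℝ → ℝ} (hβ : LocInt β) (hβ0 : ∀ t, 0 ≤ β t) {c r : ℝ}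
    (hr : 0 < r) (hc : ∀ t, ∫ u in t..(t + 1), β u ≤ c) {a t : ℝ} (hat : a ≤ t) :
    ∫ v in a..t, β v * Real.exp (-r * (t - v)) ≤ c / (1 - Real.exp (-r)) := by
  obtain ⟨n, hn⟩ := exists_nat_ge (t - a)
  refine le_trans ?_ (integral_mul_exp_nat_le hβ hβ0 hr hc n t)
  refine intervalIntegral.integral_mono_interval (by linarith) hat le_rfl
    (Eventually.of_forall fun v => mul_nonneg (hβ0 v) (Real.exp_pos _).le)
    ((hβ.intervalIntegrable _ _).mul_continuousOn (by fun_prop))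

/-- under (H1), (H2•) and (H3), there is a bounded pullback absorbing
ball, uniformly in time: the solutions of `ẋ = f(t,x)` are uniformly ultimately
bounded. -/
theorem stmt18 {N : ℕ} (f : ℝ → Euc N → Euc N) (hf : IsLC f)
    (α β : ℝ → ℝ) (hα : LocInt α) (hβ : LocInt β) (hβ0 : ∀ t, 0 ≤ β t)
    (hH1 : ∀ᵐ p : ℝ × Euc N, 2 * ⟪f p.1 p.2, p.2⟫ ≤ α p.1 * ‖p.2‖ ^ 2 + β p.1)
    (K α₁ : ℝ) (hK : 1 ≤ K) (hα₁ : 0 < α₁)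
    (hH2b : ∀ s t : ℝ, s ≤ t →
      Real.exp (∫ u in s..t, α u) ≤ K * Real.exp (-α₁ * (t - s)))
    (c₁ : ℝ) (hH3 : ∀ t : ℝ, ∫ u in t..(t + 1), β u ≤ c₁) :
    ∃ ρ > (0:ℝ), ∀ d > (0:ℝ), ∃ T > (0:ℝ), ∀ t s : ℝ, T ≤ s →
      ∀ x₀ : Euc N, ‖x₀‖ ≤ d → ∀ x : ℝ → Euc N,
        ContinuousOn x (Icc (t - s) t) →
        (∀ u ∈ Icc (t - s) t, x u = x₀ + ∫ v in (t - s)..u, f v (x v)) →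
        ‖x t‖ ≤ ρ := by
  have hq : 0 < 1 - Real.exp (-α₁) := by simpa using hα₁
  have hc₁ : 0 ≤ c₁ := (intervalIntegral.integral_nonneg (by simp) fun u _ => hβ0 u).trans (hH3 0)
  have hR : 0 < K + K * (c₁ / (1 - Real.exp (-α₁))) := by positivity
  refine ⟨√(K + K * (c₁ / (1 - Real.exp (-α₁)))), Real.sqrt_pos.mpr hR, fun d hd =>
    ⟨d ^ 2 / α₁, by positivity, fun t s hs x₀ hx₀ x hx hsol => Real.le_sqrt_of_sq_le ?_⟩⟩
  have hs0 : 0 ≤ s := le_trans (by positivity) hs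
  have hts : t - s ≤ t := by linarith
  refine (hf.norm_sq_le hα hβ hH1 hts hx hsol).trans (add_le_add ?_ ?_)
  · have h1 := hH2b (t - s) t hts
    rw [sub_sub_cancel] at h1
    have h2 : d ^ 2 * Real.exp (-α₁ * s) ≤ 1 := by
      rw [neg_mul, Real.exp_neg, ← div_eq_mul_inv, div_le_one (Real.exp_pos _)]
      rw [div_le_iff₀ hα₁] at hs
      linarith [Real.add_one_le_exp (α₁ * s)]
    calc ‖x₀‖ ^ 2 * Real.exp (∫ u in (t - s)..t, α u)
        ≤ d ^ 2 * (K * Real.exp (-α₁ * s)) := by gcongr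
      _ = K * (d ^ 2 * Real.exp (-α₁ * s)) := by ring
      _ ≤ K * 1 := by gcongr
      _ = K := mul_one K
  · have hE : ContinuousOn (fun v => Real.exp (∫ u in v..t, α u)) (uIcc (t - s) t) := by
      simp_rw [fun v => intervalIntegral.integral_symm (μ := volume) (f := α) t v]
      exact ((hα.intervalIntegrable _ _).absolutelyContinuousOnInterval_intervalIntegral
        right_mem_uIcc).neg.exp.continuousOn
    calc ∫ v in (t - s)..t, β v * Real.exp (∫ u in v..t, α u)
        ≤ ∫ v in (t - s)..t, K * (β v * Real.exp (-α₁ * (t - v))) := by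
          refine intervalIntegral.integral_mono_on hts
            ((hβ.intervalIntegrable _ _).mul_continuousOn hE)
            (((hβ.intervalIntegrable _ _).mul_continuousOn (by fun_prop)).const_mul K)
            fun v hv => ?_
          rw [mul_left_comm]
          exact mul_le_mul_of_nonneg_left (hH2b v t hv.2) (hβ0 v)
      _ = K * ∫ v in (t - s)..t, β v * Real.exp (-α₁ * (t - v)) :=
          intervalIntegral.integral_const_mul _ _
      _ ≤ K * (c₁ / (1 - Real.exp (-α₁))) := by
          gcongr
          exact integral_mul_exp_le hβ hβ0 hα₁ hH3 hts
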